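/- For every β ≥ 0 there exist constants C > 0, M > 0 and L₀ > 0 such that for all L > 0 and α > 0 with L·α ≥ M and L ≤ L₀, the first min-max value Λ₁ := inf over nonzero u ∈ C¹([−L,L]; ℂ) of t^β_{L,α}(u)/∫_{−L}^{L}|u(x)|² dx satisfies −α²/4 − C·α²·e^{−Lα/2} ≤ Λ₁ < −α²/4. -/

import Mathlib

open MeasureTheory

/-- The quadratic form of the one-dimensional Laplacian on `(-L, L)` with an attractive
δ-interaction of strength `α` at the origin and `β`-Robin boundary conditions at `±L`:
`t^β_{L,α}(u) = ∫_{-L}^{L} |u'(x)|² dx − α |u(0)|² − β(|u(-L)|² + |u(L)|²)`. -/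
noncomputable def tFormRobin (L α β : ℝ) (u : ℝ → ℂ) : ℝ :=
  (∫ x in (-L)..L, ‖deriv u x‖ ^ 2) - α * ‖u 0‖ ^ 2 - β * (‖u (-L)‖ ^ 2 + ‖u L‖ ^ 2)

/-- The first min-max value of `t^β_{L,α}`: the infimum of the Rayleigh quotient over
nonzero `C¹` functions on `[-L, L]` (no boundary condition imposed). -/
noncomputable def lambda1Robin (L α β : ℝ) : ℝ :=
  sInf {r : ℝ | ∃ u : ℝ → ℂ, ContDiff ℝ 1 u ∧
    (∃ x ∈ Set.Icc (-L) L, u x ≠ 0) ∧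
    r = tFormRobin L α β u / ∫ x in (-L)..L, ‖u x‖ ^ 2}

/-- Picone-type inequality: if `φ` solves the Riccati equation `φ' = K - φ²`, then
`φ |u|²` at the endpoints is controlled by `∫ |u'|² + K |u|²`. -/
theorem boundary_le_of_riccati {a b K : ℝ} (hab : a ≤ b) {φ : ℝ → ℝ}
    (hφ : ∀ x, HasDerivAt φ (K - φ x ^ 2) x) {u : ℝ → ℂ} (hu : ContDiff ℝ 1 u) :
    φ b * ‖u b‖ ^ 2 - φ a * ‖u a‖ ^ 2 ≤
      (∫ x in a..b, ‖deriv u x‖ ^ 2) + K * ∫ x in a..b, ‖u x‖ ^ 2 := by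
  have hd : ∀ x, HasDerivAt u (deriv u x) x := fun x =>
    (hu.differentiable one_ne_zero x).hasDerivAt
  have hc : Continuous u := hu.continuous
  have hc' : Continuous (deriv u) := hu.continuous_deriv le_rfl
  have hφc : Continuous φ := continuous_iff_continuousAt.2 fun x => (hφ x).continuousAt
  have hF : ∀ x, HasDerivAt (fun y => φ y * ‖u y‖ ^ 2)
      ((K - φ x ^ 2) * ‖u x‖ ^ 2 + φ x * (2 * inner ℝ (u x) (deriv u x))) x := fun x =>
    (hφ x).mul (hd x).norm_sq
  have hF'c : Continuous fun x =>
      (K - φ x ^ 2) * ‖u x‖ ^ 2 + φ x * (2 * inner ℝ (u x) (deriv u x)) := by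
    fun_prop
  rw [← intervalIntegral.integral_eq_sub_of_hasDerivAt (fun x _ => hF x)
      (hF'c.intervalIntegrable _ _), ← intervalIntegral.integral_const_mul,
    ← intervalIntegral.integral_add
      (Continuous.intervalIntegrable (by fun_prop) _ _)
      (Continuous.intervalIntegrable (by fun_prop) _ _)]
  refine intervalIntegral.integral_mono_on hab (hF'c.intervalIntegrable _ _)
    (Continuous.intervalIntegrable (by fun_prop) _ _) fun x _ => ?_
  have h := sq_nonneg ‖deriv u x - φ x • u x‖
  have h1 := norm_sub_sq_real (deriv u x) (φ x • u x)
  rw [real_inner_smul_right, norm_smul, mul_pow, Real.norm_eq_abs, sq_abs,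
    real_inner_comm] at h1
  linarith

/-- The solution `w'/w` of the Riccati equation `φ' = k² - φ²` coming from
`w x = b exp (k x) + exp (-k x)`. -/
theorem hasDerivAt_riccati_solution {b k : ℝ} (hb : 0 ≤ b) (x : ℝ) :
    HasDerivAt (fun y => k * (b * Real.exp (k * y) - Real.exp (-(k * y))) /
        (b * Real.exp (k * y) + Real.exp (-(k * y))))
      (k ^ 2 - (k * (b * Real.exp (k * x) - Real.exp (-(k * x))) /
        (b * Real.exp (k * x) + Real.exp (-(k * x)))) ^ 2) x := by
  have hw : b * Real.exp (k * x) + Real.exp (-(k * x)) ≠ 0 := by positivity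
  have hk : HasDerivAt (fun y => k * y) k x := by
    simpa using (hasDerivAt_id x).const_mul k
  have h1 := hk.exp.const_mul b
  have h2 := hk.fun_neg.exp
  refine (((h1.fun_sub h2).const_mul k).fun_div (h1.fun_add h2) hw).congr_deriv ?_
  field_simp
  ring

theorem integral_symm_split {f : ℝ → ℝ} (hf : Continuous f) (L : ℝ) :
    ∫ x in (-L)..L, f x = (∫ x in (0 : ℝ)..L, f (-x)) + ∫ x in (0 : ℝ)..L, f x := by
  rw [intervalIntegral.integral_comp_neg, neg_zero,
    intervalIntegral.integral_add_adjacent_intervals (hf.intervalIntegrable _ _)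
      (hf.intervalIntegrable _ _)]

theorem tFormRobin_ge_of_riccati {L α β K : ℝ} (hL : 0 ≤ L) {φ : ℝ → ℝ}
    (hφ : ∀ x, HasDerivAt φ (K - φ x ^ 2) x) (h0 : φ 0 ≤ -(α / 2)) (hφL : β ≤ φ L)
    {u : ℝ → ℂ} (hu : ContDiff ℝ 1 u) :
    -K * ∫ x in (-L)..L, ‖u x‖ ^ 2 ≤ tFormRobin L α β u := by
  have hc : Continuous u := hu.continuous
  have hc' : Continuous (deriv u) := hu.continuous_deriv le_rfl
  have hr := boundary_le_of_riccati hL hφ hu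
  have hl := boundary_le_of_riccati hL hφ (u := fun x => u (-x)) (hu.comp contDiff_neg)
  simp only [deriv_comp_neg, norm_neg, neg_zero] at hl
  unfold tFormRobin
  rw [integral_symm_split (f := fun x => ‖u x‖ ^ 2) (by fun_prop),
    integral_symm_split (f := fun x => ‖deriv u x‖ ^ 2) (by fun_prop)]
  have e1 := mul_le_mul_of_nonneg_right hφL (sq_nonneg ‖u L‖)
  have e2 := mul_le_mul_of_nonneg_right hφL (sq_nonneg ‖u (-L)‖)
  have e3 := mul_le_mul_of_nonneg_right h0 (sq_nonneg ‖u 0‖)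
  linarith

theorem neg_le_rayleigh_of_riccati {L α β K : ℝ} (hL : 0 < L) {φ : ℝ → ℝ}
    (hφ : ∀ x, HasDerivAt φ (K - φ x ^ 2) x) (h0 : φ 0 ≤ -(α / 2)) (hφL : β ≤ φ L)
    {u : ℝ → ℂ} (hu : ContDiff ℝ 1 u) (hne : ∃ x ∈ Set.Icc (-L) L, u x ≠ 0) :
    -K ≤ tFormRobin L α β u / ∫ x in (-L)..L, ‖u x‖ ^ 2 := by
  have hc : Continuous u := hu.continuous
  obtain ⟨x, hx, hux⟩ := hne
  rw [le_div_iff₀ (intervalIntegral.integral_pos (by linarith)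
    (Continuous.continuousOn (by fun_prop)) (fun _ _ => by positivity)
    ⟨x, hx, by positivity⟩)]
  exact tFormRobin_ge_of_riccati hL.le hφ h0 hφL hu

/-- A smooth regularisation of `exp (-α |x| / 2)` has Rayleigh quotient below `-α² / 4`. -/
theorem exists_rayleigh_lt {L α β : ℝ} (hL : 0 < L) (hα : 0 < α) (hβ : 0 ≤ β) :
    ∃ u : ℝ → ℂ, ContDiff ℝ 1 u ∧ (∃ x ∈ Set.Icc (-L) L, u x ≠ 0) ∧
      tFormRobin L α β u / (∫ x in (-L)..L, ‖u x‖ ^ 2) < -α ^ 2 / 4 := by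
  obtain ⟨ε, hε, hεe⟩ : ∃ ε > 0, α * ε = Real.exp (-(α * L)) / 2 :=
    ⟨Real.exp (-(α * L)) / 2 / α, by positivity, by field_simp⟩
  have hpos : ∀ x : ℝ, 0 < x ^ 2 + ε ^ 2 := fun x => by positivity
  set s : ℝ → ℝ := fun x => Real.sqrt (x ^ 2 + ε ^ 2) with hs
  have hspos : ∀ x, 0 < s x := fun x => Real.sqrt_pos.2 (hpos x)
  have hsabs : ∀ x, |x| ≤ s x := fun x => Real.abs_le_sqrt (by nlinarith [sq_nonneg ε])
  have hscd : ContDiff ℝ 1 s := ContDiff.sqrt (by fun_prop) fun x => (hpos x).ne'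
  have hsd : ∀ x, HasDerivAt s (x / s x) x := fun x => by
    have := hspos x
    refine (((hasDerivAt_id x).fun_pow 2).add_const (ε ^ 2)).sqrt (hpos x).ne' |>.congr_deriv ?_
    change (2 : ℕ) * x ^ (2 - 1) * 1 / (2 * s x) = x / s x
    push_cast
    field_simp
  set g : ℝ → ℝ := fun x => Real.exp (-(α / 2 * s x)) with hg
  have hgcd : ContDiff ℝ 1 g := Real.contDiff_exp.comp (contDiff_const.mul hscd).neg
  have hgc : Continuous g := hgcd.continuous
  have hgd : ∀ x, HasDerivAt g (g x * -(α / 2 * (x / s x))) x := fun x =>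
    ((hsd x).const_mul (α / 2)).fun_neg.exp
  have hgpos : ∀ x, 0 < g x := fun x => Real.exp_pos _
  have hcd : ContDiff ℝ 1 fun x => (g x : ℂ) := Complex.ofRealCLM.contDiff.comp hgcd
  have hnorm : ∀ x, ‖(g x : ℂ)‖ = g x := fun x => by
    rw [Complex.norm_real, Real.norm_of_nonneg (hgpos x).le]
  have hderiv : ∀ x, ‖deriv (fun y => (g y : ℂ)) x‖ ^ 2 ≤ α ^ 2 / 4 * g x ^ 2 := fun x => by
    rw [(hgd x).ofReal_comp.deriv, Complex.norm_real, Real.norm_eq_abs, sq_abs, mul_pow]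
    have : (x / s x) ^ 2 ≤ 1 := by
      rw [div_pow, div_le_one (by have := hspos x; positivity)]
      exact sq_le_sq.2 ((hsabs x).trans (le_abs_self _))
    nlinarith [mul_le_mul_of_nonneg_left this (by positivity : 0 ≤ α ^ 2 / 4 * g x ^ 2)]
  have hgsq : ∀ x, g x ^ 2 = Real.exp (-(α * s x)) := fun x => by
    rw [hg, ← Real.exp_nat_mul]
    congr 1
    push_cast
    ring
  have hnormsq : ∫ x in (-L)..L, g x ^ 2 ≤ 2 * ((1 - Real.exp (-(α * L))) / α) := by
    have heven : ∀ x, g (-x) = g x := fun x => by simp [hg, hs]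
    rw [integral_symm_split (f := fun x => g x ^ 2) (by fun_prop)]
    simp only [heven]
    rw [← two_mul]
    have hE : ∀ x, HasDerivAt (fun y => -(Real.exp (-(α * y)) / α)) (Real.exp (-(α * x))) x :=
      fun x => by
        refine (((hasDerivAt_id x).const_mul α).fun_neg.exp.div_const α).fun_neg.congr_deriv ?_
        simp only [id]
        field_simp
    have hI : ∫ x in (0 : ℝ)..L, Real.exp (-(α * x)) = (1 - Real.exp (-(α * L))) / α := by
      rw [intervalIntegral.integral_eq_sub_of_hasDerivAt (fun x _ => hE x)
        (Continuous.intervalIntegrable (by fun_prop) _ _)]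
      simp
      ring
    rw [← hI]
    gcongr
    refine intervalIntegral.integral_mono_on hL.le
      (Continuous.intervalIntegrable (by fun_prop) _ _)
      (Continuous.intervalIntegrable (by fun_prop) _ _) fun x _ => ?_
    rw [hgsq]
    gcongr
    exact (le_abs_self x).trans (hsabs x)
  have hden : 0 < ∫ x in (-L)..L, g x ^ 2 :=
    intervalIntegral.integral_pos (by linarith) (Continuous.continuousOn (by fun_prop))
      (fun _ _ => by positivity) ⟨0, ⟨by linarith, hL.le⟩, by have := hgpos 0; positivity⟩
  have hkin : ∫ x in (-L)..L, ‖deriv (fun y => (g y : ℂ)) x‖ ^ 2 ≤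
      α ^ 2 / 4 * ∫ x in (-L)..L, g x ^ 2 := by
    have hc' := hcd.continuous_deriv le_rfl
    rw [← intervalIntegral.integral_const_mul]
    exact intervalIntegral.integral_mono_on (by linarith)
      (Continuous.intervalIntegrable (by fun_prop) _ _)
      (Continuous.intervalIntegrable (by fun_prop) _ _) fun x _ => hderiv x
  have hzero : 1 - α * ε ≤ g 0 ^ 2 := by
    have hs0 : s 0 = ε := by simp [hs, Real.sqrt_sq hε.le]
    rw [hgsq, hs0]
    linarith [Real.add_one_le_exp (-(α * ε))]
  refine ⟨fun x => (g x : ℂ), hcd, ⟨0, ⟨by linarith, hL.le⟩, ?_⟩, ?_⟩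
  · exact Complex.ofReal_ne_zero.2 (hgpos 0).ne'
  · simp only [tFormRobin, hnorm]
    rw [div_lt_iff₀ hden]
    have e1 := mul_le_mul_of_nonneg_left hnormsq (by positivity : 0 ≤ α ^ 2 / 2)
    have e2 : α ^ 2 / 2 * (2 * ((1 - Real.exp (-(α * L))) / α)) =
        α * (1 - Real.exp (-(α * L))) := by
      field_simp
    have e3 := mul_le_mul_of_nonneg_left hzero hα.le
    have e4 : 0 ≤ β * (g (-L) ^ 2 + g L ^ 2) := by positivity
    have e5 : 0 < α * Real.exp (-(α * L)) := by positivity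
    rw [hεe] at e3
    linarith

/-- For `L α ≥ 4` and `α ≥ 6 β` there is a Riccati solution adapted to the boundary conditions
with constant exponentially close to `α² / 4`. -/
theorem exists_riccati_solution {L α β : ℝ} (hL : 0 < L) (hα : 0 < α) (hM : 4 ≤ L * α)
    (hβ : 6 * β ≤ α) :
    ∃ K : ℝ, ∃ φ : ℝ → ℝ, (∀ x, HasDerivAt φ (K - φ x ^ 2) x) ∧ φ 0 ≤ -(α / 2) ∧ β ≤ φ L ∧
      K ≤ α ^ 2 / 4 + 8 * α ^ 2 * Real.exp (-(L * α) / 2) := by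
  set e := Real.exp (-(L * α)) with he
  have hepos : 0 < e := Real.exp_pos _
  have he5 : e ≤ 1 / 5 := by
    have h1 : 5 ≤ Real.exp (L * α) := by linarith [Real.add_one_le_exp (L * α)]
    rw [he, Real.exp_neg, inv_le_comm₀ (by positivity) (by norm_num)]
    linarith
  have hee : e ≤ Real.exp (-(L * α) / 2) := Real.exp_le_exp.2 (by linarith)
  set b := 2 * e with hb
  have hb0 : 0 < b := by positivity
  have h1b : 0 < 1 - b := by linarith
  obtain ⟨k, hk⟩ : ∃ k, k * (1 - b) = α / 2 * (1 + b) :=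
    ⟨α / 2 * (1 + b) / (1 - b), by field_simp⟩
  have hkα : α / 2 ≤ k := by
    by_contra! h
    nlinarith
  have hkpos : 0 < k := by linarith
  refine ⟨k ^ 2, _, hasDerivAt_riccati_solution (k := k) hb0.le, ?_, ?_, ?_⟩
  · simp only [mul_zero, neg_zero, Real.exp_zero, mul_one]
    rw [div_le_iff₀ (by positivity)]
    linarith
  · have hw : 0 < b * Real.exp (k * L) + Real.exp (-(k * L)) := by positivity
    rw [le_div_iff₀ hw]
    have hle : 2 * Real.exp (-(k * L)) ≤ b * Real.exp (k * L) := by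
      rw [hb, he, mul_assoc, ← Real.exp_add]
      gcongr
      nlinarith
    have hβk : β ≤ k / 3 := by linarith
    have := mul_le_mul_of_nonneg_right hβk hw.le
    nlinarith
  · have h : (k ^ 2 - α ^ 2 / 4) * (1 - b) ^ 2 = α ^ 2 * b := by
      have : k ^ 2 * (1 - b) ^ 2 = (α / 2 * (1 + b)) ^ 2 := by rw [← hk]; ring
      linarith
    have h2 : 1 / 4 ≤ (1 - b) ^ 2 := by nlinarith
    have h3 : 0 ≤ k ^ 2 - α ^ 2 / 4 := by nlinarith
    have h4 := mul_le_mul_of_nonneg_left h2 h3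
    have h5 := mul_le_mul_of_nonneg_left hee (sq_nonneg α)
    rw [h, hb] at h4
    linarith

theorem stmt7 : ∀ β : ℝ, 0 ≤ β → ∃ C > (0 : ℝ), ∃ M > (0 : ℝ), ∃ L₀ > (0 : ℝ),
    ∀ L α : ℝ, 0 < L → 0 < α → M ≤ L * α → L ≤ L₀ →
      -α ^ 2 / 4 - C * α ^ 2 * Real.exp (-(L * α) / 2) ≤ lambda1Robin L α β ∧
        lambda1Robin L α β < -α ^ 2 / 4 := by
  intro β hβ
  refine ⟨8, by norm_num, 4, by norm_num, 1 / (2 * (β + 1)), by positivity, ?_⟩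
  intro L α hL hα hM hL₀
  have hβα : 6 * β ≤ α := by
    rw [le_div_iff₀ (by positivity)] at hL₀
    by_contra! h
    nlinarith [mul_lt_mul_of_pos_left h hL]
  obtain ⟨K, φ, hφ, h0, hφL, hK⟩ := exists_riccati_solution hL hα hM hβα
  obtain ⟨u, hu, hne, hlt⟩ := exists_rayleigh_lt hL hα hβ
  unfold lambda1Robin
  set S := {r : ℝ | ∃ u : ℝ → ℂ, ContDiff ℝ 1 u ∧
      (∃ x ∈ Set.Icc (-L) L, u x ≠ 0) ∧
      r = tFormRobin L α β u / ∫ x in (-L)..L, ‖u x‖ ^ 2}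
  have hbound : ∀ r ∈ S, -K ≤ r := by
    rintro r ⟨v, hv, hvne, rfl⟩
    exact neg_le_rayleigh_of_riccati hL hφ h0 hφL hv hvne
  have hmem : tFormRobin L α β u / (∫ x in (-L)..L, ‖u x‖ ^ 2) ∈ S := ⟨u, hu, hne, rfl⟩
  constructor
  · have := le_csInf ⟨_, hmem⟩ hbound
    linarith
  · exact (csInf_le ⟨-K, hbound⟩ hmem).trans_lt hlt
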